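/- arXiv:2001.07690 — 9 statements merged into one kernel-verified Lean document; each statement's English description precedes it below -/
import Mathlib

section
/- The functions φ0 and φ1 solve the linear system of ordinary differential equations governing the mean cell numbers: for all t ∈ ℝ, φ0'(t) = a11·φ0(t) + a21·φ1(t) and φ1'(t) = a12·φ0(t) + a22·φ1(t), with initial conditions φ0(0) = n and φ1(0) = m. -/
theorem stmt_6 (a11 a22 a12 a21 : ℝ) (h12 : a12 > 0) (h21 : a21 > 0)
    (σ ρ δ γ : ℝ)
    (hσ : σ = ((a11 + a22) + Real.sqrt ((a11 - a22) ^ 2 + 4 * a12 * a21)) / 2)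
    (hρ : ρ = ((a11 + a22) - Real.sqrt ((a11 - a22) ^ 2 + 4 * a12 * a21)) / 2)
    (hδ : δ = (a11 - ρ) / a21) (hγ : γ = (σ - a11) / a21)
    (n m α β : ℝ)
    (hα : α = (n * γ - m) / (δ + γ)) (hβ : β = (n * δ + m) / (δ + γ))
    (φ0 φ1 : ℝ → ℝ)
    (hφ0 : ∀ t, φ0 t = β * Real.exp (σ * t) + α * Real.exp (ρ * t))
    (hφ1 : ∀ t, φ1 t = γ * β * Real.exp (σ * t) - δ * α * Real.exp (ρ * t)) :
    (∀ t : ℝ, HasDerivAt φ0 (a11 * φ0 t + a21 * φ1 t) t ∧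
      HasDerivAt φ1 (a12 * φ0 t + a22 * φ1 t) t) ∧ φ0 0 = n ∧ φ1 0 = m := by
  have hne : a21 ≠ 0 := h21.ne'
  have hDpos : 0 < (a11 - a22) ^ 2 + 4 * a12 * a21 := by positivity
  have hsq := Real.sq_sqrt hDpos.le
  have hs := Real.sqrt_pos.mpr hDpos
  set s := Real.sqrt ((a11 - a22) ^ 2 + 4 * a12 * a21) with hsdef
  have e1 : a21 * γ = σ - a11 := by rw [hγ]; field_simp
  have e2 : a21 * δ = a11 - ρ := by rw [hδ]; field_simp
  have e3 : a12 + a22 * γ = σ * γ := by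
    apply mul_left_cancel₀ hne
    have : a12 * a21 + a22 * (σ - a11) = σ * (σ - a11) := by
      rw [hσ]; linear_combination (-1 / 4) * hsq
    linear_combination this + (a22 - σ) * e1
  have e4 : a12 - a22 * δ = -(ρ * δ) := by
    apply mul_left_cancel₀ hne
    have : a12 * a21 - a22 * (a11 - ρ) = -(ρ * (a11 - ρ)) := by
      rw [hρ]; linear_combination (-1 / 4) * hsq
    linear_combination this + (ρ - a22) * e2
  have hsum : δ + γ ≠ 0 := by
    intro h
    have : a21 * (δ + γ) = s := by
      rw [mul_add, e1, e2, hσ, hρ]; ring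
    rw [h, mul_zero] at this
    linarith
  have hexp : ∀ c t : ℝ, HasDerivAt (fun t => Real.exp (c * t)) (Real.exp (c * t) * c) t := by
    intro c t
    simpa using ((hasDerivAt_id t).const_mul c).exp
  refine ⟨fun t => ⟨?_, ?_⟩, ?_, ?_⟩
  · rw [hφ0 t, hφ1 t, funext hφ0]
    refine (((hexp σ t).const_mul β).add ((hexp ρ t).const_mul α)).congr_deriv ?_
    linear_combination (-β * Real.exp (σ * t)) * e1 + (α * Real.exp (ρ * t)) * e2
  · rw [hφ0 t, hφ1 t, funext hφ1]
    refine (((hexp σ t).const_mul (γ * β)).sub ((hexp ρ t).const_mul (δ * α))).congr_deriv ?_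
    linear_combination (-β * Real.exp (σ * t)) * e3 - (α * Real.exp (ρ * t)) * e4
  · rw [hφ0, hα, hβ]
    simp only [mul_zero, Real.exp_zero]
    field_simp
    ring
  · rw [hφ1, hα, hβ]
    simp only [mul_zero, Real.exp_zero]
    field_simp
    ring
end

section
/- If n ≥ 0, m ≥ 0 and n + m > 0, then φ0(t) > 0 and φ1(t) > 0 for every t > 0 (positive regularity of the two-type mean dynamics). -/
theorem stmt_7 (a11 a22 a12 a21 : ℝ) (h12 : a12 > 0) (h21 : a21 > 0)
    (σ ρ δ γ : ℝ)
    (hσ : σ = ((a11 + a22) + Real.sqrt ((a11 - a22) ^ 2 + 4 * a12 * a21)) / 2)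
    (hρ : ρ = ((a11 + a22) - Real.sqrt ((a11 - a22) ^ 2 + 4 * a12 * a21)) / 2)
    (hδ : δ = (a11 - ρ) / a21) (hγ : γ = (σ - a11) / a21)
    (n m α β : ℝ)
    (hα : α = (n * γ - m) / (δ + γ)) (hβ : β = (n * δ + m) / (δ + γ))
    (φ0 φ1 : ℝ → ℝ)
    (hφ0 : ∀ t, φ0 t = β * Real.exp (σ * t) + α * Real.exp (ρ * t))
    (hφ1 : ∀ t, φ1 t = γ * β * Real.exp (σ * t) - δ * α * Real.exp (ρ * t))
    (hn : n ≥ 0) (hm : m ≥ 0) (hnm : n + m > 0) :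
    ∀ t : ℝ, t > 0 → φ0 t > 0 ∧ φ1 t > 0 := by
  intro t ht
  have hS : |a11 - a22| < Real.sqrt ((a11 - a22) ^ 2 + 4 * a12 * a21) := by
    apply Real.lt_sqrt_of_sq_lt
    rw [sq_abs]
    have := mul_pos h12 h21
    linarith
  obtain ⟨hS1, hS2⟩ := abs_lt.mp hS
  have hδp : 0 < δ := by
    rw [hδ]; apply div_pos _ h21; rw [hρ]; linarith
  have hγp : 0 < γ := by
    rw [hγ]; apply div_pos _ h21; rw [hσ]; linarith
  have hlt : ρ < σ := by rw [hσ, hρ]; linarith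
  have hE : Real.exp (ρ * t) < Real.exp (σ * t) :=
    Real.exp_lt_exp.mpr (mul_lt_mul_of_pos_right hlt ht)
  have hF : 0 < Real.exp (ρ * t) := Real.exp_pos _
  rw [hφ0, hφ1]
  generalize Real.exp (ρ * t) = F at *
  generalize Real.exp (σ * t) = E at *
  have hEp : 0 < E := hF.trans hE
  have hd : 0 < E - F := sub_pos.mpr hE
  have key : ∀ p q : ℝ, 0 < p → 0 < q → 0 < n * p + m * q := by
    intro p q hp hq
    rcases hn.lt_or_eq with h | h
    · have := mul_pos h hp
      have := mul_nonneg hm hq.le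
      linarith
    · have hm' : 0 < m := by linarith
      have := mul_pos hm' hq
      have := mul_nonneg hn hp.le
      linarith
  have e0 : β * E + α * F = (n * (δ * E + γ * F) + m * (E - F)) / (δ + γ) := by
    rw [hα, hβ]; ring
  have e1 : γ * β * E - δ * α * F
      = (n * (γ * δ * (E - F)) + m * (γ * E + δ * F)) / (δ + γ) := by
    rw [hα, hβ]; ring
  rw [e0, e1]
  exact ⟨div_pos (key _ _ (by positivity) hd) (by positivity),
    div_pos (key _ _ (by positivity) (by positivity)) (by positivity)⟩
end

section
/- The sign of σ is determined by the sign of ν·λ0 + μ·λ1 − λ0·λ1: one has σ < 0 if and only if ν·λ0 + μ·λ1 < λ0·λ1; σ = 0 if and only if ν·λ0 + μ·λ1 = λ0·λ1; and σ > 0 if and only if ν·λ0 + μ·λ1 > λ0·λ1. -/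
theorem stmt_8 (lam0 lam1 mu nu : ℝ)
    (h0 : lam0 < 0) (h1 : lam1 > 0) (hmu : mu > 0) (hnu : nu > 0)
    (σ : ℝ)
    (hσ : σ = ((lam0 - mu) + (lam1 - nu) +
      Real.sqrt (((lam0 - mu) - (lam1 - nu)) ^ 2 + 4 * mu * nu)) / 2) :
    (σ < 0 ↔ nu * lam0 + mu * lam1 < lam0 * lam1) ∧
    (σ = 0 ↔ nu * lam0 + mu * lam1 = lam0 * lam1) ∧
    (σ > 0 ↔ nu * lam0 + mu * lam1 > lam0 * lam1) := by
  have hp : 0 < mu * nu := mul_pos hmu hnu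
  have hs := Real.sq_sqrt (show 0 ≤ ((lam0 - mu) - (lam1 - nu)) ^ 2 + 4 * mu * nu by nlinarith [sq_nonneg ((lam0 - mu) - (lam1 - nu))])
  have hlt : (lam1 - nu) - (lam0 - mu) < Real.sqrt (((lam0 - mu) - (lam1 - nu)) ^ 2 + 4 * mu * nu) :=
    Real.lt_sqrt_of_sq_lt (by nlinarith)
  generalize Real.sqrt (((lam0 - mu) - (lam1 - nu)) ^ 2 + 4 * mu * nu) = s at *
  obtain ⟨t, ht⟩ : ∃ t, t = (s - (lam0 - mu) - (lam1 - nu)) / 2 := ⟨_, rfl⟩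
  have htp : 0 < t := by linarith
  have key : nu * lam0 + mu * lam1 - lam0 * lam1 = σ * t := by
    rw [hσ, ht]; linear_combination -hs / 4
  refine ⟨?_, ?_, ?_⟩
  · rw [← sub_neg (b := lam0 * lam1), key]; exact ⟨fun h => mul_neg_of_neg_of_pos h htp, fun h => by by_contra hc; push Not at hc; exact absurd (mul_nonneg hc htp.le) (not_le.mpr h)⟩
  · rw [← sub_eq_zero (a := nu * lam0 + mu * lam1), key, mul_eq_zero_iff_right htp.ne']
  · rw [gt_iff_lt, gt_iff_lt, ← sub_pos (b := lam0 * lam1), key, mul_pos_iff_of_pos_right htp]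
end

section
/- If λ1 ≥ ν, then ν·λ0 + μ·λ1 > λ0·λ1, and consequently σ > 0; i.e. retention of the resistant phenotype satisfying λ1 ≥ ν is a sufficient condition for supercriticality. -/
theorem stmt_9 (lam0 lam1 mu nu : ℝ)
    (h0 : lam0 < 0) (h1 : lam1 > 0) (hmu : mu > 0) (hnu : nu > 0)
    (σ : ℝ)
    (hσ : σ = ((lam0 - mu) + (lam1 - nu) +
      Real.sqrt (((lam0 - mu) - (lam1 - nu)) ^ 2 + 4 * mu * nu)) / 2)
    (h : lam1 ≥ nu) :
    nu * lam0 + mu * lam1 > lam0 * lam1 ∧ σ > 0 := by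
  have key : nu * lam0 + mu * lam1 > lam0 * lam1 := by
    nlinarith [mul_nonneg (neg_nonneg.mpr h0.le) (sub_nonneg.mpr h), mul_pos hmu h1]
  refine ⟨key, ?_⟩
  have h2 : -((lam0 - mu) + (lam1 - nu)) <
      Real.sqrt (((lam0 - mu) - (lam1 - nu)) ^ 2 + 4 * mu * nu) := by
    apply Real.lt_sqrt_of_sq_lt
    nlinarith [key]
  rw [hσ]
  linarith
end

section
/- The supercriticality region is bounded by the critical line in the (μ, ν) plane: σ > 0 if and only if ν < (λ1/|λ0|)·μ + λ1. -/
theorem stmt_11 (lam0 lam1 mu nu : ℝ)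
    (h0 : lam0 < 0) (h1 : lam1 > 0) (hmu : mu > 0) (hnu : nu > 0)
    (σ : ℝ)
    (hσ : σ = ((lam0 - mu) + (lam1 - nu) +
      Real.sqrt (((lam0 - mu) - (lam1 - nu)) ^ 2 + 4 * mu * nu)) / 2) :
    σ > 0 ↔ nu < lam1 / |lam0| * mu + lam1 := by
  have key : nu < lam1 / |lam0| * mu + lam1 ↔ (lam0 - mu) * (lam1 - nu) - mu * nu < 0 := by
    rw [abs_of_neg h0]
    have hp : 0 < -lam0 := by linarith
    have e : lam1 / -lam0 * mu + lam1 = (lam1 * mu + lam1 * -lam0) / -lam0 := by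
      rw [eq_div_iff hp.ne', add_mul, mul_right_comm, div_mul_cancel₀ _ hp.ne']
    rw [e, lt_div_iff₀ hp]
    constructor <;> intro h <;> nlinarith
  rw [key]
  have hmn : 0 < mu * nu := mul_pos hmu hnu
  have ha : lam0 - mu < 0 := by linarith
  generalize lam0 - mu = a at *
  generalize lam1 - nu = b at *
  constructor
  · intro h
    by_contra hd
    push Not at hd
    have hb : b < 0 := by
      by_contra hb
      push Not at hb
      nlinarith [mul_nonneg (neg_nonneg.2 ha.le) hb]
    have : Real.sqrt ((a - b) ^ 2 + 4 * mu * nu) ≤ -(a + b) := by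
      apply Real.sqrt_le_iff.2
      constructor
      · linarith
      · nlinarith
    linarith
  · intro hd
    have : -(a + b) < Real.sqrt ((a - b) ^ 2 + 4 * mu * nu) := by
      apply Real.lt_sqrt_of_sq_lt
      nlinarith
    linarith
end

section
/- If n ≥ 0, m ≥ 0 and n + m > 0, then the ratio of the two mean population sizes converges to γ: φ1(t)/φ0(t) → γ as t → ∞; that is, γ is the long-run ratio between type-1 and type-0 cells. -/
open Filter in
theorem stmt_12 (a11 a22 a12 a21 : ℝ) (h12 : a12 > 0) (h21 : a21 > 0)
    (σ ρ δ γ : ℝ)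
    (hσ : σ = ((a11 + a22) + Real.sqrt ((a11 - a22) ^ 2 + 4 * a12 * a21)) / 2)
    (hρ : ρ = ((a11 + a22) - Real.sqrt ((a11 - a22) ^ 2 + 4 * a12 * a21)) / 2)
    (hδ : δ = (a11 - ρ) / a21) (hγ : γ = (σ - a11) / a21)
    (n m α β : ℝ)
    (hα : α = (n * γ - m) / (δ + γ)) (hβ : β = (n * δ + m) / (δ + γ))
    (φ0 φ1 : ℝ → ℝ)
    (hφ0 : ∀ t, φ0 t = β * Real.exp (σ * t) + α * Real.exp (ρ * t))
    (hφ1 : ∀ t, φ1 t = γ * β * Real.exp (σ * t) - δ * α * Real.exp (ρ * t))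
    (hn : n ≥ 0) (hm : m ≥ 0) (hnm : n + m > 0) :
    Tendsto (fun t => φ1 t / φ0 t) atTop (nhds γ) := by
  have hpos : 0 < a12 * a21 := mul_pos h12 h21
  set s := Real.sqrt ((a11 - a22) ^ 2 + 4 * a12 * a21) with hs
  have habs : |a11 - a22| < s := by
    rw [hs, ← Real.sqrt_sq_eq_abs]
    exact Real.sqrt_lt_sqrt (sq_nonneg _) (by nlinarith)
  obtain ⟨h1, h2⟩ := abs_lt.mp habs
  have hδ0 : 0 < δ := by
    rw [hδ]; exact div_pos (by rw [hρ]; linarith) h21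
  have hγ0 : 0 < γ := by
    rw [hγ]; exact div_pos (by rw [hσ]; linarith) h21
  have hlt : 0 < σ - ρ := by
    rw [hσ, hρ]; linarith [abs_nonneg (a11 - a22)]
  have hβ0 : 0 < β := by
    rw [hβ]
    refine div_pos ?_ (by linarith)
    rcases hn.lt_or_eq with h | h
    · have := mul_pos h hδ0
      linarith
    · rw [← h] at hnm ⊢
      linarith
  have hE : Tendsto (fun t : ℝ => Real.exp (-((σ - ρ) * t))) atTop (nhds 0) :=
    Real.tendsto_exp_neg_atTop_nhds_zero.comp (tendsto_id.const_mul_atTop hlt)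
  have hlim : Tendsto (fun t : ℝ => (γ * β - δ * α * Real.exp (-((σ - ρ) * t))) /
      (β + α * Real.exp (-((σ - ρ) * t)))) atTop
      (nhds ((γ * β - δ * α * 0) / (β + α * 0))) :=
    (tendsto_const_nhds.sub (hE.const_mul _)).div
      (tendsto_const_nhds.add (hE.const_mul _)) (by simpa using hβ0.ne')
  have hval : (γ * β - δ * α * 0) / (β + α * 0) = γ := by
    have := hβ0.ne'
    simp [this]
  rw [hval] at hlim
  refine hlim.congr fun t => ?_
  have he : Real.exp (ρ * t) = Real.exp (-((σ - ρ) * t)) * Real.exp (σ * t) := by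
    rw [← Real.exp_add]; congr 1; ring
  rw [hφ0, hφ1, he, ← mul_div_mul_right _ _ (Real.exp_pos (σ * t)).ne']
  congr 1 <;> ring
end

section
/- Define the mean total clone sizes ψ10(t) := (δ·(1+γ)/(δ+γ))·e^(σ·t) + (γ·(1−δ)/(δ+γ))·e^(ρ·t) (clone started by one type-0 cell) and ψ01(t) := ((1+γ)/(δ+γ))·e^(σ·t) − ((1−δ)/(δ+γ))·e^(ρ·t) (clone started by one type-1 cell). Then ψ10(t)/ψ01(t) → δ as t → ∞; that is, δ is the long-run ratio between the mean size of a clone derived from a single type-0 cell versus a single type-1 cell. -/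
open Filter in
theorem stmt_14 (a11 a22 a12 a21 : ℝ) (h12 : a12 > 0) (h21 : a21 > 0)
    (σ ρ δ γ : ℝ)
    (hσ : σ = ((a11 + a22) + Real.sqrt ((a11 - a22) ^ 2 + 4 * a12 * a21)) / 2)
    (hρ : ρ = ((a11 + a22) - Real.sqrt ((a11 - a22) ^ 2 + 4 * a12 * a21)) / 2)
    (hδ : δ = (a11 - ρ) / a21) (hγ : γ = (σ - a11) / a21)
    (ψ10 ψ01 : ℝ → ℝ)
    (hψ10 : ∀ t, ψ10 t = δ * (1 + γ) / (δ + γ) * Real.exp (σ * t) +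
      γ * (1 - δ) / (δ + γ) * Real.exp (ρ * t))
    (hψ01 : ∀ t, ψ01 t = (1 + γ) / (δ + γ) * Real.exp (σ * t) -
      (1 - δ) / (δ + γ) * Real.exp (ρ * t)) :
    Tendsto (fun t => ψ10 t / ψ01 t) atTop (nhds δ) := by
  have hpos : 0 < 4 * a12 * a21 := by positivity
  have hs : |a11 - a22| < Real.sqrt ((a11 - a22) ^ 2 + 4 * a12 * a21) := by
    rw [← Real.sqrt_sq_eq_abs]
    exact Real.sqrt_lt_sqrt (sq_nonneg _) (by linarith)
  obtain ⟨hs1, hs2⟩ := abs_lt.mp hs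
  have hδ0 : 0 < δ := by
    rw [hδ]; apply div_pos _ h21; rw [hρ]; linarith
  have hγ0 : 0 < γ := by
    rw [hγ]; apply div_pos _ h21; rw [hσ]; linarith
  have hlt : ρ - σ < 0 := by
    rw [hρ, hσ]; linarith
  clear hσ hρ hδ hγ hs hs1 hs2
  have hE : Tendsto (fun t : ℝ => Real.exp ((ρ - σ) * t)) atTop (nhds 0) :=
    Real.tendsto_exp_atBot.comp (tendsto_id.const_mul_atTop_of_neg hlt)
  have hN : Tendsto (fun t : ℝ => δ * (1 + γ) + γ * (1 - δ) * Real.exp ((ρ - σ) * t)) atTop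
      (nhds (δ * (1 + γ) + γ * (1 - δ) * 0)) := (hE.const_mul _).const_add _
  have hD : Tendsto (fun t : ℝ => (1 + γ) - (1 - δ) * Real.exp ((ρ - σ) * t)) atTop
      (nhds ((1 + γ) - (1 - δ) * 0)) := (hE.const_mul _).const_sub _
  have h := hN.div hD (by simp; positivity)
  have hlim : (δ * (1 + γ) + γ * (1 - δ) * 0) / ((1 + γ) - (1 - δ) * 0) = δ := by
    have : 1 + γ ≠ 0 := by positivity
    simp [this]
  rw [hlim] at h
  refine h.congr fun t => ?_
  have hc : Real.exp (σ * t) / (δ + γ) ≠ 0 := by positivity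
  have he : Real.exp (ρ * t) = Real.exp ((ρ - σ) * t) * Real.exp (σ * t) := by
    rw [← Real.exp_add]; ring_nf
  rw [hψ10, hψ01, he, Pi.div_apply, ← mul_div_mul_right _ _ hc]
  congr 1 <;> ring
end

section
/- In the supercritical regime, the extinction-probability system has a unique solution with both coordinates strictly less than one: there exists exactly one pair (p0, p1) ∈ [0,1) × [0,1) satisfying (r0 + d0 + μ)·p0 = r0·p0² + d0 + μ·p1 and (r1 + d1 + ν)·p1 = r1·p1² + d1 + ν·p0. -/
theorem aux_lt (r a r1 b mu nu x y x' y' : ℝ) (hr : 0 < r) (ha : 0 < a) (hr1 : 0 < r1)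
    (hmu : 0 < mu) (hnu : 0 < nu) (hx : 0 < x) (hy : 0 < y)
    (e1 : mu * y = x * (r * x + a + mu)) (e2 : nu * x = y * (r1 * y + nu - b))
    (e1' : mu * y' = x' * (r * x' + a + mu)) (e2' : nu * x' = y' * (r1 * y' + nu - b))
    (h : x < x') : False := by
  have hx' : 0 < x' := hx.trans h
  have hyy : y < y' := by
    have : mu * y < mu * y' := by
      rw [e1, e1']
      have : r * x + a + mu < r * x' + a + mu := by nlinarith
      exact mul_lt_mul'' h this hx.le (by positivity)
    exact lt_of_mul_lt_mul_left this hmu.le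
  -- (r x + a + mu) * (r1 y + nu - b) = mu nu
  have k : (r * x + a + mu) * (r1 * y + nu - b) = mu * nu := by
    have : x * y * ((r * x + a + mu) * (r1 * y + nu - b)) = x * y * (mu * nu) := by
      linear_combination (-(y * (r1 * y + nu - b))) * e1 - mu * y * e2
    exact mul_left_cancel₀ (by positivity) this
  have hy' : 0 < y' := hy.trans hyy
  have k' : (r * x' + a + mu) * (r1 * y' + nu - b) = mu * nu := by
    have : x' * y' * ((r * x' + a + mu) * (r1 * y' + nu - b)) = x' * y' * (mu * nu) := by
      linear_combination (-(y' * (r1 * y' + nu - b))) * e1' - mu * y' * e2'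
    exact mul_left_cancel₀ (by positivity) this
  have hp : 0 < r1 * y + nu - b := by
    have : 0 < (r * x + a + mu) * (r1 * y + nu - b) := by rw [k]; positivity
    exact (pos_iff_pos_of_mul_pos this).1 (by positivity)
  have h1 : r * x + a + mu < r * x' + a + mu := by nlinarith
  have h2 : r1 * y + nu - b < r1 * y' + nu - b := by nlinarith
  have := mul_lt_mul'' h1 h2 (by positivity) hp.le
  linarith

theorem aux_ex (r a r1 b mu nu : ℝ) (hr : 0 < r) (ha : 0 < a)
    (hmu : 0 < mu) (hnu : 0 < nu) (hb : b < r1)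
    (hs : a * nu - a * b - mu * b < 0) :
    ∃ x y : ℝ, 0 < x ∧ x ≤ 1 ∧ 0 < y ∧ y ≤ 1 ∧ 
    mu * y = x * (r * x + a + mu) ∧ nu * x = y * (r1 * y + nu - b) := by
  obtain ⟨z, ⟨hz0, hz1⟩, hz⟩ := intermediate_value_Icc (zero_le_one (α := ℝ))
    (f := fun x : ℝ => x * (r * x + a + mu)) (by fun_prop)
    (show mu ∈ _ by constructor <;> simp <;> linarith)
  simp only at hz
  obtain ⟨x, ⟨hx0, hx1⟩, hx⟩ := intermediate_value_Icc hz0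
    (f := fun x : ℝ => (r * x + a + mu) * (r1 * (x * (r * x + a + mu) / mu) + nu - b) - mu * nu)
    (by fun_prop)
    (show (0:ℝ) ∈ _ by
      constructor
      · simp; nlinarith
      · simp only [hz]
        rw [div_self hmu.ne']
        have : mu ≤ r * z + a + mu := by nlinarith [mul_nonneg hr.le hz0]
        nlinarith [mul_nonneg (by linarith : 0 ≤ r * z + a + mu) (by linarith : 0 ≤ r1 - b)])
  simp only at hx
  have hxp : 0 < x := by
    rcases hx0.lt_or_eq with h | h
    · exact h
    · subst h; simp at hx; nlinarith
  refine ⟨x, x * (r * x + a + mu) / mu, hxp, hx1.trans hz1, by positivity, ?_, by field_simp, ?_⟩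
  · rw [div_le_one hmu]
    calc x * (r * x + a + mu) ≤ z * (r * z + a + mu) := by gcongr
      _ = mu := hz
  · generalize hy : x * (r * x + a + mu) / mu = y at *
    have e : mu * y = x * (r * x + a + mu) := by rw [← hy]; field_simp
    apply mul_left_cancel₀ hmu.ne'
    linear_combination (-x) * hx - (r1 * y + nu - b) * e

theorem stmt_17 (r0 d0 r1 d1 mu nu : ℝ)
    (hr0 : r0 > 0) (hd0 : d0 > 0) (hr1 : r1 > 0) (hd1 : d1 > 0)
    (hmu : mu > 0) (hnu : nu > 0)
    (h0 : r0 - d0 < 0) (h1 : r1 - d1 > 0)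
    (hsup : nu * (r0 - d0) + mu * (r1 - d1) > (r0 - d0) * (r1 - d1)) :
    ∃! p : ℝ × ℝ, p.1 ∈ Set.Ico (0:ℝ) 1 ∧ p.2 ∈ Set.Ico (0:ℝ) 1 ∧
      (r0 + d0 + mu) * p.1 = r0 * p.1 ^ 2 + d0 + mu * p.2 ∧
      (r1 + d1 + nu) * p.2 = r1 * p.2 ^ 2 + d1 + nu * p.1 := by
  obtain ⟨x, y, hx, hx1, hy, hy1, e1, e2⟩ := aux_ex r0 (d0 - r0) r1 (r1 - d1) mu nu hr0
    (by linarith) hmu hnu (by linarith) (by nlinarith)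
  refine ⟨(1 - x, 1 - y), ⟨⟨by simpa using hx1, by simpa using hx⟩,
    ⟨by simpa using hy1, by simpa using hy⟩, by simp only; linear_combination e1,
    by simp only; linear_combination e2⟩, ?_⟩
  rintro ⟨p, q⟩ ⟨⟨hp0, hp1⟩, ⟨hq0, hq1⟩, f1, f2⟩
  simp only at *
  have g1 : mu * (1 - q) = (1 - p) * (r0 * (1 - p) + (d0 - r0) + mu) := by
    linear_combination f1
  have g2 : nu * (1 - p) = (1 - q) * (r1 * (1 - q) + nu - (r1 - d1)) := by
    linear_combination f2
  have hxp : x = 1 - p := by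
    rcases lt_trichotomy x (1 - p) with h | h | h
    · exact (aux_lt r0 (d0 - r0) r1 (r1 - d1) mu nu x y _ _ hr0 (by linarith) hr1 hmu hnu hx hy
        e1 e2 g1 g2 h).elim
    · exact h
    · exact (aux_lt r0 (d0 - r0) r1 (r1 - d1) mu nu _ _ x y hr0 (by linarith) hr1 hmu hnu
        (by linarith) (by linarith) g1 g2 e1 e2 h).elim
  have hyq : y = 1 - q := by
    apply mul_left_cancel₀ hmu.ne'
    rw [e1, g1, hxp]
  rw [hxp, hyq]; simp
end

section
/- In the subcritical regime, the extinction-probability system has only the trivial solution in the unit square: if (p0, p1) ∈ [0,1] × [0,1] satisfies (r0 + d0 + μ)·p0 = r0·p0² + d0 + μ·p1 and (r1 + d1 + ν)·p1 = r1·p1² + d1 + ν·p0, then p0 = 1 and p1 = 1. -/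
theorem stmt_18 (r0 d0 r1 d1 mu nu : ℝ)
    (hr0 : r0 > 0) (hd0 : d0 > 0) (hr1 : r1 > 0) (hd1 : d1 > 0)
    (hmu : mu > 0) (hnu : nu > 0)
    (h0 : r0 - d0 < 0) (h1 : r1 - d1 > 0)
    (hsub : nu * (r0 - d0) + mu * (r1 - d1) < (r0 - d0) * (r1 - d1)) :
    ∀ p0 p1 : ℝ, p0 ∈ Set.Icc (0:ℝ) 1 → p1 ∈ Set.Icc (0:ℝ) 1 →
      (r0 + d0 + mu) * p0 = r0 * p0 ^ 2 + d0 + mu * p1 →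
      (r1 + d1 + nu) * p1 = r1 * p1 ^ 2 + d1 + nu * p0 →
      p0 = 1 ∧ p1 = 1 := by
  intro p0 p1 ⟨_, hp0⟩ ⟨_, hp1⟩ e0 e1
  have a0 : (mu - (r0 - d0)) * (1 - p0) ≤ mu * (1 - p1) := by
    nlinarith [mul_nonneg hr0.le (sq_nonneg (1 - p0))]
  have a1 : (nu - (r1 - d1)) * (1 - p1) ≤ nu * (1 - p0) := by
    nlinarith [mul_nonneg hr1.le (sq_nonneg (1 - p1))]
  have b0 := mul_le_mul_of_nonneg_left a0 hnu.le
  have hpos : 0 ≤ mu - (r0 - d0) := by linarith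
  have b1 := mul_le_mul_of_nonneg_left a1 hpos
  have c : ((r0 - d0) * (r1 - d1) - (nu * (r0 - d0) + mu * (r1 - d1))) * (1 - p1) ≤ 0 := by
    linarith
  have hy : 1 - p1 ≤ 0 := nonpos_of_mul_nonpos_right c (by linarith)
  have hp : p1 = 1 := by linarith
  subst hp
  refine ⟨?_, rfl⟩
  have : nu * (1 - p0) = 0 := by linarith
  rcases mul_eq_zero.mp this with h | h <;> linarith
end
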